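/- Let n ≥ 1, let 𝐗 ⊆ ℝ≥0^n be an interval and C(𝐚) an interval circulant matrix. Then there exists x ∈ 𝐗 such that x ∈ Attr(A) for every A ∈ C(𝐚) (i.e., 𝐗 is possibly C(𝐚)-robust) if and only if there exists x ∈ 𝐗 satisfying λ(A^{(i)})·((A^{(i)})^{n²}⊗x) = (A^{(i)})^{n²+1}⊗x for every i ∈ {0,…,n−1} with A^{(i)} ≠ 0. -/

import Mathlib

open scoped NNReal Classical

namespace MaxAlg

variable {n : ℕ}

/-- cyclic successor on `Fin k` -/
def cyc {k : ℕ} (l : Fin k) : Fin k := ⟨(l.val + 1) % k, Nat.mod_lt _ l.pos⟩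

/-- max-algebraic matrix product -/
noncomputable def mmul (A B : Matrix (Fin n) (Fin n) ℝ≥0) : Matrix (Fin n) (Fin n) ℝ≥0 :=
  fun i k => Finset.univ.sup fun j => A i j * B j k

/-- max-algebraic identity matrix -/
def mId (n : ℕ) : Matrix (Fin n) (Fin n) ℝ≥0 := fun i j => if i = j then 1 else 0

/-- max-algebraic matrix power -/
noncomputable def mpow (A : Matrix (Fin n) (Fin n) ℝ≥0) : ℕ → Matrix (Fin n) (Fin n) ℝ≥0
  | 0 => mId n
  | t + 1 => mmul (mpow A t) A

/-- max-algebraic matrix-vector product -/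
noncomputable def mvec (A : Matrix (Fin n) (Fin n) ℝ≥0) (x : Fin n → ℝ≥0) : Fin n → ℝ≥0 :=
  fun i => Finset.univ.sup fun j => A i j * x j

/-- geometric mean of the cycle `c` of length `k` -/
noncomputable def cycMean (A : Matrix (Fin n) (Fin n) ℝ≥0) (k : ℕ) (c : Fin k → Fin n) : ℝ≥0 :=
  (∏ l : Fin k, A (c l) (c (cyc l))) ^ ((1 : ℝ) / (k : ℝ))

/-- maximum cycle geometric mean λ(A) -/
noncomputable def lam (A : Matrix (Fin n) (Fin n) ℝ≥0) : ℝ≥0 :=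
  (Finset.Icc 1 n).sup fun k => Finset.univ.sup fun c : Fin k → Fin n => cycMean A k c

/-- attraction cone Attr(A) -/
def Attr (A : Matrix (Fin n) (Fin n) ℝ≥0) : Set (Fin n → ℝ≥0) :=
  {x | ∃ s : ℕ, mvec (mpow A (s + 1)) x = fun i => lam A * mvec (mpow A s) x i}

/-- circulant matrix built from the vector of values `a_0, …, a_{n-1}` -/
def circ (a : Fin n → ℝ≥0) : Matrix (Fin n) (Fin n) ℝ≥0 := fun i j => a (j - i)

/-- A is a circulant matrix -/
def IsCirculant (A : Matrix (Fin n) (Fin n) ℝ≥0) : Prop := ∃ a : Fin n → ℝ≥0, A = circ a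

/-- (i,j) is a critical edge of A -/
def IsCritEdge (A : Matrix (Fin n) (Fin n) ℝ≥0) (i j : Fin n) : Prop :=
  A i j ≠ 0 ∧ ∃ (k : ℕ) (c : Fin k → Fin n), 1 ≤ k ∧
    (∀ l, A (c l) (c (cyc l)) ≠ 0) ∧
    cycMean A k c = lam A ∧ ∃ l, c l = i ∧ c (cyc l) = j

/-- there is a walk of length ≥ 1 from i to j in crit(A) -/
def CritWalk (A : Matrix (Fin n) (Fin n) ℝ≥0) (i j : Fin n) : Prop :=
  ∃ l : ℕ, 1 ≤ l ∧ ∃ w : ℕ → Fin n, w 0 = i ∧ w l = j ∧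
    ∀ r < l, IsCritEdge A (w r) (w (r + 1))

/-- node i lies on a critical cycle of A -/
def OnCritCycle (A : Matrix (Fin n) (Fin n) ℝ≥0) (i : Fin n) : Prop :=
  ∃ (k : ℕ) (c : Fin k → Fin n), 1 ≤ k ∧
    (∀ l, A (c l) (c (cyc l)) ≠ 0) ∧
    cycMean A k c = lam A ∧ ∃ l, c l = i

/-- family of one-dimensional intervals with bounds `lo`, `hi`,
each of one of the four forms -/
def IsIntervalFam (S : Fin n → Set ℝ≥0) (lo hi : Fin n → ℝ≥0) : Prop :=
  ∀ i, (S i).Nonempty ∧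
    (S i = Set.Icc (lo i) (hi i) ∨ S i = Set.Ico (lo i) (hi i) ∨
     S i = Set.Ioc (lo i) (hi i) ∨ S i = Set.Ioo (lo i) (hi i))

/-- the interval 𝐗 ⊆ ℝ≥0ⁿ determined by the family S -/
def box (S : Fin n → Set ℝ≥0) : Set (Fin n → ℝ≥0) := {x | ∀ i, x i ∈ S i}

/-- vertex x^{(k)}: x̄ in coordinate k and x̲ elsewhere -/
def vtx (lo hi : Fin n → ℝ≥0) (k : Fin n) : Fin n → ℝ≥0 :=
  Function.update lo k (hi k)

/-- the interval circulant matrix C(𝐚) determined by the interval family Sa -/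
def Cset (Sa : Fin n → Set ℝ≥0) : Set (Matrix (Fin n) (Fin n) ℝ≥0) :=
  {A | ∃ a : Fin n → ℝ≥0, (∀ k, a k ∈ Sa k) ∧ A = circ a}

/-- the matrix Â, with â_k = min(a̲, ā_k) where a̲ = max_k a̲_k -/
noncomputable def Ahat (alo ahi : Fin n → ℝ≥0) : Matrix (Fin n) (Fin n) ℝ≥0 :=
  circ fun k => min (Finset.univ.sup alo) (ahi k)

/-- the matrix A^{(k)} = Circulant(a̲_0,…,a̲_{k−1}, ā_k, a̲_{k+1},…,a̲_{n−1}) -/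
def Ak (alo ahi : Fin n → ℝ≥0) (k : Fin n) : Matrix (Fin n) (Fin n) ℝ≥0 :=
  circ (Function.update alo k (ahi k))

end MaxAlg

namespace MaxAlg

variable {n : ℕ}

/-- The max-linear operator with circulant weights `c`: `(circOp c x) i = max_j c_j · x_{i+j}`. -/
noncomputable def circOp (c x : Fin n → ℝ≥0) : Fin n → ℝ≥0 :=
  fun i => Finset.univ.sup fun j => c j * x (i + j)

/-- The cyclic shift of a vector by `u`. -/
def shift (u : Fin n) (x : Fin n → ℝ≥0) : Fin n → ℝ≥0 := fun i => x (i + u)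

theorem mvec_mId (x : Fin n → ℝ≥0) : mvec (mId n) x = x := by
  funext i
  apply le_antisymm
  · refine Finset.sup_le fun j _ => ?_
    by_cases h : i = j <;> simp [mId, h]
  · refine le_trans ?_ (Finset.le_sup (Finset.mem_univ i))
    simp [mId]

theorem mvec_mmul (A B : Matrix (Fin n) (Fin n) ℝ≥0) (x : Fin n → ℝ≥0) :
    mvec (mmul A B) x = mvec A (mvec B x) := by
  funext i
  simp only [mvec, mmul, NNReal.finset_sup_mul, NNReal.mul_finset_sup]
  rw [Finset.sup_comm]
  simp only [mul_assoc]

theorem mvec_mpow (A : Matrix (Fin n) (Fin n) ℝ≥0) (t : ℕ) (x : Fin n → ℝ≥0) :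
    mvec (mpow A t) x = (mvec A)^[t] x := by
  induction t generalizing x with
  | zero => exact mvec_mId x
  | succ t ih => rw [mpow, mvec_mmul, ih, Function.iterate_succ_apply]

theorem circOp_mono {c d : Fin n → ℝ≥0} (h : c ≤ d) {x y : Fin n → ℝ≥0} (hxy : x ≤ y) :
    circOp c x ≤ circOp d y :=
  fun i => Finset.sup_mono_fun fun j _ => mul_le_mul' (h j) (hxy (i + j))

theorem circOp_iterate_mono {c d : Fin n → ℝ≥0} (h : c ≤ d) (t : ℕ) {x y : Fin n → ℝ≥0}
    (hxy : x ≤ y) : (circOp c)^[t] x ≤ (circOp d)^[t] y := by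
  induction t with
  | zero => exact hxy
  | succ t ih =>
    rw [Function.iterate_succ_apply', Function.iterate_succ_apply']
    exact circOp_mono h ih

theorem circOp_smul (c : Fin n → ℝ≥0) (r : ℝ≥0) (x : Fin n → ℝ≥0) :
    circOp c (r • x) = r • circOp c x := by
  funext i
  simp only [circOp, Pi.smul_apply, smul_eq_mul, NNReal.mul_finset_sup]
  exact Finset.sup_congr rfl fun j _ => mul_left_comm _ _ _

theorem circOp_zero_left (x : Fin n → ℝ≥0) : circOp 0 x = 0 := by
  funext i
  simp [circOp]

theorem circOp_shift (c : Fin n → ℝ≥0) (u : Fin n) (x : Fin n → ℝ≥0) :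
    circOp c (shift u x) = shift u (circOp c x) := by
  funext i
  simp only [circOp, shift, add_right_comm]

theorem commute_circOp_shift (c : Fin n → ℝ≥0) (u : Fin n) :
    Function.Commute (circOp c) (shift u) :=
  circOp_shift c u

/-- The weights `a`, divided by `a k` and re-indexed so that `k` moves to `0`. -/
noncomputable def normalized (a : Fin n → ℝ≥0) (k : Fin n) : Fin n → ℝ≥0 :=
  fun j => a (j + k) / a k

theorem normalized_le_one {a : Fin n → ℝ≥0} {k : Fin n} (hmax : ∀ j, a j ≤ a k) (j : Fin n) :
    normalized a k j ≤ 1 :=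
  div_le_one_of_le₀ (hmax _) zero_le

section NeZero

variable [NeZero n]

theorem mvec_circ (a x : Fin n → ℝ≥0) : mvec (circ a) x = circOp a x := by
  funext i
  apply le_antisymm
  · refine Finset.sup_le fun j _ => ?_
    refine le_trans ?_ (Finset.le_sup (Finset.mem_univ (j - i)))
    simp [circ]
  · refine Finset.sup_le fun j _ => ?_
    refine le_trans ?_ (Finset.le_sup (Finset.mem_univ (i + j)))
    simp [circ]

theorem shift_shift (u v : Fin n) (x : Fin n → ℝ≥0) :
    shift u (shift v x) = shift (u + v) x := by
  funext i
  simp only [shift, add_assoc]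

theorem shift_zero (x : Fin n → ℝ≥0) : shift 0 x = x := by
  funext i
  simp only [shift, add_zero]

theorem shift_injective (u : Fin n) : Function.Injective (shift u) := fun x y h => by
  simpa only [shift_shift, neg_add_cancel, shift_zero] using congrArg (shift (-u)) h

theorem le_circOp {c : Fin n → ℝ≥0} (h0 : c 0 = 1) (x : Fin n → ℝ≥0) : x ≤ circOp c x := by
  intro i
  refine le_trans ?_ (Finset.le_sup (Finset.mem_univ 0))
  simp [h0]

theorem le_circOp_iterate {c : Fin n → ℝ≥0} (h0 : c 0 = 1) (t : ℕ) (x : Fin n → ℝ≥0) :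
    x ≤ (circOp c)^[t] x :=
  Function.id_le_iterate_of_id_le (le_circOp h0) t x

/-- If the value at `i` still grows at step `t`, then more than `t` coordinates are at least as
large as the new value. -/
theorem lt_card_of_circOp_iterate_lt {c : Fin n → ℝ≥0} (h0 : c 0 = 1) (h1 : ∀ j, c j ≤ 1)
    (x : Fin n → ℝ≥0) (t : ℕ) (i : Fin n)
    (hi : (circOp c)^[t] x i < (circOp c)^[t + 1] x i) :
    t < (Finset.univ.filter fun u =>
      (circOp c)^[t + 1] x i ≤ (circOp c)^[t + 1] x u).card := by
  induction t generalizing i with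
  | zero => exact Finset.card_pos.mpr ⟨i, by simp⟩
  | succ t ih =>
    have hmono : ∀ s, (circOp c)^[s] x ≤ (circOp c)^[s + 1] x := fun s => by
      rw [Function.iterate_succ_apply']
      exact le_circOp h0 _
    obtain ⟨j, -, hj⟩ := Finset.exists_mem_eq_sup (Finset.univ : Finset (Fin n))
      Finset.univ_nonempty fun j => c j * (circOp c)^[t + 1] x (i + j)
    replace hj : (circOp c)^[t + 1 + 1] x i = c j * (circOp c)^[t + 1] x (i + j) := by
      rw [Function.iterate_succ_apply']
      exact hj
    have hlt : (circOp c)^[t] x (i + j) < (circOp c)^[t + 1] x (i + j) := by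
      by_contra! hle
      refine hi.not_ge ?_
      rw [hj]
      refine (mul_le_mul_right hle (c j)).trans ?_
      rw [Function.iterate_succ_apply']
      exact Finset.le_sup (f := fun j => c j * (circOp c)^[t] x (i + j)) (Finset.mem_univ j)
    have hle : (circOp c)^[t + 1 + 1] x i ≤ (circOp c)^[t + 1] x (i + j) := by
      rw [hj]
      exact mul_le_of_le_one_left' (h1 j)
    refine (Nat.succ_le_of_lt (ih (i + j) hlt)).trans_lt (Finset.card_lt_card ?_)
    refine Finset.ssubset_iff_of_subset ?_ |>.mpr ⟨i, ?_, ?_⟩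
    · intro u hu
      simp only [Finset.mem_filter, Finset.mem_univ, true_and] at hu ⊢
      exact hle.trans (hu.trans (hmono _ u))
    · exact Finset.mem_filter.mpr ⟨Finset.mem_univ i, le_rfl⟩
    · simp only [Finset.mem_filter, Finset.mem_univ, true_and, not_le]
      exact hi.trans_le hle

theorem circOp_iterate_stable {c : Fin n → ℝ≥0} (h0 : c 0 = 1) (h1 : ∀ j, c j ≤ 1)
    (x : Fin n → ℝ≥0) {t : ℕ} (ht : n ≤ t) :
    circOp c ((circOp c)^[t] x) = (circOp c)^[t] x := by
  refine le_antisymm (fun i => ?_) (le_circOp h0 _)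
  by_contra! hlt
  rw [← Function.iterate_succ_apply' (circOp c)] at hlt
  have hcard := lt_card_of_circOp_iterate_lt h0 h1 x t i hlt
  have := (Finset.card_le_univ (Finset.univ.filter fun u =>
      (circOp c)^[t + 1] x i ≤ (circOp c)^[t + 1] x u)).trans_eq (Fintype.card_fin n)
  omega

theorem circOp_iterate_add_stable {c : Fin n → ℝ≥0} (h0 : c 0 = 1) (h1 : ∀ j, c j ≤ 1)
    (x : Fin n → ℝ≥0) {t : ℕ} (ht : n ≤ t) (s : ℕ) :
    (circOp c)^[s] ((circOp c)^[t] x) = (circOp c)^[t] x :=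
  Function.iterate_fixed (circOp_iterate_stable h0 h1 x ht) s

theorem normalized_zero {a : Fin n → ℝ≥0} {k : Fin n} (hk : a k ≠ 0) : normalized a k 0 = 1 := by
  simp [normalized, hk]

theorem circOp_eq_smul_shift {a : Fin n → ℝ≥0} {k : Fin n} (hk : a k ≠ 0) (x : Fin n → ℝ≥0) :
    circOp a x = a k • shift k (circOp (normalized a k) x) := by
  funext i
  simp only [circOp, shift, normalized, Pi.smul_apply, smul_eq_mul, NNReal.mul_finset_sup]
  apply le_antisymm
  · refine Finset.sup_le fun j _ => ?_
    refine le_trans ?_ (Finset.le_sup (Finset.mem_univ (j - k)))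
    rw [sub_add_cancel, ← mul_assoc, mul_div_cancel₀ _ hk, add_assoc, add_sub_cancel]
  · refine Finset.sup_le fun j _ => ?_
    refine le_trans ?_ (Finset.le_sup (Finset.mem_univ (j + k)))
    rw [← mul_assoc, mul_div_cancel₀ _ hk, add_assoc, add_comm k]

theorem circOp_iterate_eq_smul_shift {a : Fin n → ℝ≥0} {k : Fin n} (hk : a k ≠ 0) (t : ℕ)
    (x : Fin n → ℝ≥0) :
    (circOp a)^[t] x = a k ^ t • shift (t • k) ((circOp (normalized a k))^[t] x) := by
  induction t with
  | zero => simp [shift_zero]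
  | succ t ih =>
    rw [Function.iterate_succ_apply', ih, circOp_smul, circOp_eq_smul_shift hk, circOp_shift,
      shift_shift, smul_smul, ← pow_succ, ← succ_nsmul', ← Function.iterate_succ_apply' (circOp _)]

theorem smul_circOp_iterate_eq_iff {a : Fin n → ℝ≥0} {k : Fin n} (hk : a k ≠ 0) (t : ℕ)
    (x : Fin n → ℝ≥0) :
    a k • (circOp a)^[t] x = (circOp a)^[t + 1] x ↔
      (circOp (normalized a k))^[t] x = shift k ((circOp (normalized a k))^[t + 1] x) := by
  rw [circOp_iterate_eq_smul_shift hk, circOp_iterate_eq_smul_shift hk, smul_smul, ← pow_succ',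
    succ_nsmul, ← shift_shift, (smul_right_injective _ (pow_ne_zero (t + 1) hk)).eq_iff,
    (shift_injective _).eq_iff]

theorem smul_circOp_iterate_eq_iff_shift {a : Fin n → ℝ≥0} {k : Fin n} (hk : a k ≠ 0)
    (hmax : ∀ j, a j ≤ a k) {t : ℕ} (ht : n ≤ t) (x : Fin n → ℝ≥0) :
    a k • (circOp a)^[t] x = (circOp a)^[t + 1] x ↔
      shift k ((circOp (normalized a k))^[t] x) = (circOp (normalized a k))^[t] x := by
  rw [smul_circOp_iterate_eq_iff hk, Function.iterate_succ_apply',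
    circOp_iterate_stable (normalized_zero hk) (normalized_le_one hmax) x ht, eq_comm]

theorem smul_circOp_iterate_eq_of_exists {a : Fin n → ℝ≥0} {k : Fin n} (hk : a k ≠ 0)
    (hmax : ∀ j, a j ≤ a k) {s t : ℕ} (ht : n ≤ t) {x : Fin n → ℝ≥0}
    (hs : a k • (circOp a)^[s] x = (circOp a)^[s + 1] x) :
    a k • (circOp a)^[t] x = (circOp a)^[t + 1] x := by
  rw [smul_circOp_iterate_eq_iff_shift hk hmax ht]
  rw [smul_circOp_iterate_eq_iff hk] at hs
  have h := congrArg (circOp (normalized a k))^[t] hs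
  have hst := circOp_iterate_add_stable (normalized_zero hk) (normalized_le_one hmax) x ht
  rw [((commute_circOp_shift _ k).iterate_left t).eq, ← Function.iterate_add_apply,
    ← Function.iterate_add_apply, add_comm t, add_comm t, Function.iterate_add_apply,
    Function.iterate_add_apply, hst, hst] at h
  exact h.symm

/-- Shift-invariance of the stable orbit passes to larger weights. -/
theorem shift_circOp_iterate_of_le {c d : Fin n → ℝ≥0} (hcd : c ≤ d) (hc0 : c 0 = 1)
    (hd0 : d 0 = 1) (hd1 : ∀ j, d j ≤ 1) {t : ℕ} (ht : n ≤ t) {k : Fin n} {x : Fin n → ℝ≥0}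
    (hx : shift k ((circOp c)^[t] x) = (circOp c)^[t] x) :
    shift k ((circOp d)^[t] x) = (circOp d)^[t] x := by
  have key : (circOp d)^[t] x = (circOp d)^[t] ((circOp c)^[t] x) := by
    apply le_antisymm
    · exact circOp_iterate_mono le_rfl t (le_circOp_iterate hc0 t x)
    · refine (circOp_iterate_mono le_rfl t (circOp_iterate_mono hcd t le_rfl)).trans_eq ?_
      exact circOp_iterate_add_stable hd0 hd1 x ht t
  rw [key, ← ((commute_circOp_shift d k).iterate_left t).eq, hx]

theorem lam_circ {a : Fin n → ℝ≥0} : lam (circ a) = Finset.univ.sup a := by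
  apply le_antisymm
  · refine Finset.sup_le fun k hk => Finset.sup_le fun c _ => ?_
    have hk0 : (k : ℝ) ≠ 0 := by
      have := (Finset.mem_Icc.mp hk).1
      positivity
    rw [cycMean, one_div, NNReal.rpow_inv_le_iff (by positivity), NNReal.rpow_natCast]
    refine (Finset.prod_le_pow_card _ _ _ fun l _ =>
      Finset.le_sup (f := a) (Finset.mem_univ _)).trans_eq ?_
    simp
  · refine Finset.sup_le fun k _ => ?_
    have hn : n ∈ Finset.Icc 1 n := Finset.mem_Icc.mpr ⟨NeZero.one_le, le_rfl⟩
    refine le_trans ?_ (Finset.le_sup hn)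
    refine le_trans ?_ (Finset.le_sup (Finset.mem_univ fun l : Fin n => l.val • k))
    have hstep : ∀ l : Fin n, circ a (l.val • k) ((cyc l).val • k) = a k := fun l => by
      have : (cyc l).val • k = (l.val + 1) • k := by
        simpa [cyc] using mod_natCard_nsmul k (l.val + 1)
      rw [circ, this, succ_nsmul, add_sub_cancel_left]
    rw [cycMean, Finset.prod_congr rfl fun l _ => hstep l]
    simp only [Finset.prod_const, Finset.card_univ, Fintype.card_fin]
    rw [one_div, NNReal.pow_rpow_inv_natCast _ (NeZero.ne n)]

theorem exists_sup_eq (a : Fin n → ℝ≥0) :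
    ∃ k, Finset.univ.sup a = a k ∧ ∀ j, a j ≤ a k := by
  obtain ⟨k, -, hk⟩ := Finset.exists_mem_eq_sup Finset.univ Finset.univ_nonempty a
  exact ⟨k, hk, fun j => hk ▸ Finset.le_sup (Finset.mem_univ j)⟩

theorem mem_Attr_circ_iff {a x : Fin n → ℝ≥0} {t : ℕ} (ht : n ≤ t) :
    x ∈ Attr (circ a) ↔ Finset.univ.sup a • (circOp a)^[t] x = (circOp a)^[t + 1] x := by
  have hop : mvec (circ a) = circOp a := funext (mvec_circ a)
  constructor
  · rintro ⟨s, hs⟩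
    rw [mvec_mpow, mvec_mpow, hop, lam_circ] at hs
    obtain ⟨k, hk, hmax⟩ := exists_sup_eq a
    by_cases hk0 : a k = 0
    · have ha : a = 0 := funext fun j => le_antisymm ((hmax j).trans_eq hk0) zero_le
      rw [hk, hk0, Function.iterate_succ_apply', ha, circOp_zero_left, zero_smul]
    · rw [hk] at hs ⊢
      exact smul_circOp_iterate_eq_of_exists hk0 hmax ht hs.symm
  · intro h
    refine ⟨t, ?_⟩
    rw [mvec_mpow, mvec_mpow, hop, lam_circ]
    exact h.symm

end NeZero

theorem continuous_circOp_iterate (x : Fin n → ℝ≥0) (t : ℕ) :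
    Continuous fun a : Fin n → ℝ≥0 => (circOp a)^[t] x := by
  induction t with
  | zero => exact continuous_const
  | succ t ih =>
    simp only [Function.iterate_succ_apply']
    refine continuous_pi fun i => Continuous.finset_sup_apply fun j _ => ?_
    exact (continuous_apply j).mul ((continuous_apply (i + j)).comp ih)

theorem isClosed_setOf_smul_circOp_iterate_eq (x : Fin n → ℝ≥0) (t : ℕ) :
    IsClosed {a : Fin n → ℝ≥0 |
      Finset.univ.sup a • (circOp a)^[t] x = (circOp a)^[t + 1] x} := by
  refine isClosed_eq ?_ (continuous_circOp_iterate x (t + 1))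
  have hsup : Continuous fun a : Fin n → ℝ≥0 => Finset.univ.sup a :=
    Continuous.finset_sup_apply fun j _ => continuous_apply j
  exact hsup.smul (continuous_circOp_iterate x t)

theorem IsIntervalFam.closure_eq {S : Fin n → Set ℝ≥0} {lo hi : Fin n → ℝ≥0}
    (h : IsIntervalFam S lo hi) (i : Fin n) : closure (S i) = Set.Icc (lo i) (hi i) := by
  obtain ⟨hne, h | h | h | h⟩ := h i <;> rw [h] at hne ⊢
  · exact isClosed_Icc.closure_eq
  · exact closure_Ico (Set.nonempty_Ico.mp hne).ne
  · exact closure_Ioc (Set.nonempty_Ioc.mp hne).ne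
  · exact closure_Ioo (hne.elim fun y hy => (hy.1.trans hy.2).ne)

end MaxAlg

open MaxAlg in
/-- `𝐗` is possibly `C(𝐚)`-robust iff some `x ∈ 𝐗` satisfies
`λ(A⁽ⁱ⁾)·((A⁽ⁱ⁾)^{n²}⊗x) = (A⁽ⁱ⁾)^{n²+1}⊗x` for every `i` with `A⁽ⁱ⁾ ≠ 0`. -/
theorem possibly_C_robust_iff
    (n : ℕ) (hn : 1 ≤ n)
    (S : Fin n → Set ℝ≥0) (lo hi : Fin n → ℝ≥0) (hS : IsIntervalFam S lo hi)
    (Sa : Fin n → Set ℝ≥0) (alo ahi : Fin n → ℝ≥0) (hSa : IsIntervalFam Sa alo ahi)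
    (hle : ∀ k, alo k ≤ ahi k) :
    (∃ x ∈ box S, ∀ A ∈ Cset Sa, x ∈ Attr A) ↔
      ∃ x ∈ box S, ∀ i : Fin n, Ak alo ahi i ≠ 0 →
        (fun l => lam (Ak alo ahi i) * mvec (mpow (Ak alo ahi i) (n ^ 2)) x l) =
          mvec (mpow (Ak alo ahi i) (n ^ 2 + 1)) x := by
  have : NeZero n := ⟨by omega⟩
  have hT : n ≤ n ^ 2 := Nat.le_self_pow two_ne_zero n
  have hcl : ∀ k, closure (Sa k) = Set.Icc (alo k) (ahi k) := hSa.closure_eq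
  have hAk : ∀ (x : Fin n → ℝ≥0) (i : Fin n),
      ((fun l => lam (Ak alo ahi i) * mvec (mpow (Ak alo ahi i) (n ^ 2)) x l) =
          mvec (mpow (Ak alo ahi i) (n ^ 2 + 1)) x) ↔
        Finset.univ.sup (Function.update alo i (ahi i)) •
            (circOp (Function.update alo i (ahi i)))^[n ^ 2] x =
          (circOp (Function.update alo i (ahi i)))^[n ^ 2 + 1] x := fun x i => by
    rw [mvec_mpow, mvec_mpow, Ak, lam_circ, funext (mvec_circ _)]
    rfl
  constructor
  · rintro ⟨x, hx, h⟩
    refine ⟨x, hx, fun i _ => (hAk x i).mpr ?_⟩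
    have hsub : Set.univ.pi Sa ⊆ {a : Fin n → ℝ≥0 |
        Finset.univ.sup a • (circOp a)^[n ^ 2] x = (circOp a)^[n ^ 2 + 1] x} := fun a ha =>
      (mem_Attr_circ_iff hT).mp (h _ ⟨a, fun k => ha k (Set.mem_univ k), rfl⟩)
    refine closure_minimal hsub (isClosed_setOf_smul_circOp_iterate_eq x _) ?_
    rw [closure_pi_set]
    intro k _
    beta_reduce
    rw [hcl]
    rcases eq_or_ne k i with rfl | hki
    · simpa using hle k
    · simpa [hki] using hle k
  · rintro ⟨x, hx, h⟩
    refine ⟨x, hx, ?_⟩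
    rintro _ ⟨a, ha, rfl⟩
    rw [mem_Attr_circ_iff hT]
    have hmem : ∀ k, a k ∈ Set.Icc (alo k) (ahi k) := fun k => hcl k ▸ subset_closure (ha k)
    obtain ⟨k, hk, hmax⟩ := exists_sup_eq a
    by_cases hk0 : a k = 0
    · have ha0 : a = 0 := funext fun j => le_antisymm ((hmax j).trans_eq hk0) zero_le
      rw [hk, hk0, Function.iterate_succ_apply', ha0, circOp_zero_left, zero_smul]
    set b := Function.update alo k (ahi k) with hb
    have hbk : b k = ahi k := Function.update_self ..
    have hahi : ahi k ≠ 0 := ((pos_iff_ne_zero.mpr hk0).trans_le (hmem k).2).ne'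
    have hbk0 : b k ≠ 0 := hbk ▸ hahi
    have hba : ∀ j, j ≠ k → b j ≤ a j := fun j hj => by
      rw [hb, Function.update_of_ne hj]
      exact (hmem j).1
    have hbmax : ∀ j, b j ≤ b k := fun j => by
      rcases eq_or_ne j k with rfl | hj
      · exact le_rfl
      · exact ((hba j hj).trans (hmax j)).trans ((hmem k).2.trans_eq hbk.symm)
    have hsup : Finset.univ.sup b = b k :=
      le_antisymm (Finset.sup_le fun j _ => hbmax j) (Finset.le_sup (Finset.mem_univ k))
    have hne : Ak alo ahi k ≠ 0 := fun h0 => hbk0 <| by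
      simpa [Ak, circ, hbk] using congrFun (congrFun h0 0) k
    have hx' := (hAk x k).mp (h k hne)
    rw [← hb, hsup, smul_circOp_iterate_eq_iff_shift hbk0 hbmax hT] at hx'
    rw [hk, smul_circOp_iterate_eq_iff_shift hk0 hmax hT]
    refine shift_circOp_iterate_of_le (fun j => ?_) (normalized_zero hbk0) (normalized_zero hk0)
      (normalized_le_one hmax) hT hx'
    rcases eq_or_ne j 0 with rfl | hj
    · rw [normalized_zero hbk0, normalized_zero hk0]
    · refine div_le_div₀ zero_le (hba _ ?_) (pos_iff_ne_zero.mpr hk0)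
        ((hmem k).2.trans_eq hbk.symm)
      simpa using hj
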